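/- Let H be a division ring of finite dimension over its center k, with k infinite, and let F be a division ring that is a classical right quotient ring of the ring H[X] of polynomial functions on H (via an injective ring homomorphism). Then for every m ≥ 3 the symmetric group S_m occurs as the Galois group of a Galois extension of F: there exist a division ring M and an injective ring homomorphism ι : F → M such that M/F is Galois with Galois group isomorphic to S_m. -/

import Mathlib

universe u v w x

/-- The subgroup of ring automorphisms of `M` fixing the image of `ι` pointwise
(the Galois group of the extension `M/F` given by `ι`). -/
def fixingAut {F M : Type*} [DivisionRing F] [DivisionRing M] (ι : F →+* M) :
    Subgroup (RingAut M) where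
  carrier := {σ | ∀ x : F, σ (ι x) = ι x}
  one_mem' := fun _ => rfl
  mul_mem' := by
    intro a b ha hb x
    show a (b (ι x)) = ι x
    rw [hb x, ha x]
  inv_mem' := by
    intro a ha x
    show a.symm (ι x) = ι x
    conv_lhs => rw [← ha x]
    exact a.symm_apply_apply _

/-- The extension `M/F` given by `ι : F →+* M` is Galois: every element of `M` fixed by all
ring automorphisms of `M` fixing `ι(F)` pointwise lies in `ι(F)`. -/
def IsGaloisExt {F M : Type*} [DivisionRing F] [DivisionRing M] (ι : F →+* M) : Prop :=
  ∀ m : M, (∀ σ ∈ fixingAut ι, σ m = m) → m ∈ Set.range ι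

/-- The ring `H[X]` of polynomial functions on a division ring `H`: the subring of `H → H`
(with pointwise operations) generated by the constant functions and the identity function. -/
def polyFunRing (H : Type*) [DivisionRing H] : Subring (H → H) :=
  Subring.closure ({f | ∃ c : H, f = Function.const H c} ∪ {id})

/-- `F` is a classical right quotient ring of `R` via the injective ring homomorphism `φ`:
every element of `F` is of the form `φ a * (φ b)⁻¹` with `b ≠ 0`. -/
def IsClassicalRightQuotient {R F : Type*} [Ring R] [DivisionRing F] (φ : R →+* F) : Prop :=
  Function.Injective φ ∧ ∀ x : F, ∃ a b : R, b ≠ 0 ∧ x = φ a * (φ b)⁻¹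

/-- Auxiliary construction for the iterated polynomial ring. -/
noncomputable def IterPolyAux (H : Type u) [Ring H] : ℕ → ((T : Type u) × Ring T)
  | 0 => ⟨H, inferInstance⟩
  | n + 1 =>
    letI := (IterPolyAux H n).2
    ⟨Polynomial (IterPolyAux H n).1, inferInstance⟩

/-- The iterated polynomial ring `H_c[t₁, …, t_n]` in `n` central variables over `H`:
`IterPoly H 0 = H` and `IterPoly H (n + 1) = Polynomial (IterPoly H n)`. -/
def IterPoly (H : Type u) [Ring H] (n : ℕ) : Type u := (IterPolyAux H n).1

noncomputable instance (H : Type u) [Ring H] (n : ℕ) : Ring (IterPoly H n) :=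
  (IterPolyAux H n).2

open TensorProduct

section Tensor
variable {K D C Δ : Type*} [Field K] [DivisionRing D] [Ring C] [Ring Δ] [Algebra K D]
  [Algebra K C] [Algebra K Δ]

theorem finsupp_eq_zero_of_sum_mul_eq_zero [Algebra.IsCentral K D] (f : D →ₐ[K] Δ) (g : C →ₐ[K] Δ)
    (hg : Function.Injective g) (hc : ∀ x y, Commute (f x) (g y)) {ι : Type*} (b : ι → C)
    (hb : LinearIndependent K b) (c : ι →₀ D) (h : c.sum (fun i d => f d * g (b i)) = 0) :
    c = 0 := by
  classical
  induction hn : c.support.card using Nat.strong_induction_on generalizing c with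
  | _ n ih =>
  by_contra hne
  obtain ⟨i₀, hi₀⟩ := Finsupp.support_nonempty_iff.mpr hne
  have hci : c i₀ ≠ 0 := Finsupp.mem_support_iff.mp hi₀
  -- normalise the coefficient at `i₀` to `1`
  let c₁ : ι →₀ D := c.mapRange (fun d => (c i₀)⁻¹ * d) (by simp)
  have hsum₁ : c₁.sum (fun i d => f d * g (b i)) = 0 := by
    rw [Finsupp.sum_mapRange_index (by simp)]
    have := congrArg (fun z => f (c i₀)⁻¹ * z) h
    simpa [Finsupp.sum, Finset.mul_sum, mul_assoc] using this
  have hcentral : ∀ i, c₁ i ∈ Subalgebra.center K D := by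
    intro i
    rw [Subalgebra.mem_center_iff]
    intro d
    let c₂ : ι →₀ D := c₁.mapRange (fun e => d * e - e * d) (by simp)
    have hsum₂ : c₂.sum (fun i d => f d * g (b i)) = 0 := by
      rw [Finsupp.sum_mapRange_index (by simp)]
      have h1 := congrArg (fun z => f d * z) hsum₁
      have h2 := congrArg (fun z => z * f d) hsum₁
      have h3 : ∀ x y, f x * g y * f d = f (x * d) * g y := by
        intro x y
        rw [mul_assoc, ← (hc d y).eq, ← mul_assoc, map_mul]
      simp only [Finsupp.sum, Finset.mul_sum, Finset.sum_mul, h3, mul_zero, zero_mul,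
        ← mul_assoc, ← map_mul] at h1 h2 ⊢
      simp only [map_sub, sub_mul, Finset.sum_sub_distrib, h1, h2, sub_zero]
    have hlt : c₂.support.card < n := by
      rw [← hn]
      apply Finset.card_lt_card
      refine ⟨?_, fun hsub => ?_⟩
      · intro j hj
        rw [Finsupp.mem_support_iff] at hj ⊢
        intro hj0
        simp [c₂, c₁, hj0] at hj
      · have := Finsupp.mem_support_iff.mp (hsub hi₀)
        simp [c₂, c₁, hci] at this
    have := DFunLike.congr_fun (ih _ hlt c₂ hsum₂ rfl) i
    simpa [c₂, sub_eq_zero] using this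
  have hbot : ∀ i, ∃ a : K, algebraMap K D a = c₁ i := fun i =>
    Algebra.mem_bot.mp (Algebra.IsCentral.out (hcentral i))
  choose a ha using hbot
  have hzero : ∑ i ∈ c₁.support, a i • b i = 0 := by
    apply hg
    rw [map_zero, ← hsum₁, map_sum, Finsupp.sum]
    refine Finset.sum_congr rfl fun i _ => ?_
    rw [← ha i, AlgHom.commutes, map_smul, Algebra.smul_def]
  have hi₁ : c₁ i₀ ≠ 0 := by simp [c₁, hci]
  have h0 := linearIndependent_iff'.mp hb c₁.support a hzero i₀ (Finsupp.mem_support_iff.mpr hi₁)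
  exact hi₁ (by rw [← ha, h0, map_zero])

theorem tensorLift_injective_of_isCentral [Algebra.IsCentral K D] (f : D →ₐ[K] Δ)
    (g : C →ₐ[K] Δ) (hg : Function.Injective g) (hc : ∀ x y, Commute (f x) (g y)) :
    Function.Injective (Algebra.TensorProduct.lift f g hc) := by
  rw [injective_iff_map_eq_zero]
  intro x hx
  let b := Module.Basis.ofVectorSpace K C
  let B := b.baseChange D
  have hrep := B.linearCombination_repr x
  rw [← hrep, Finsupp.linearCombination_apply, map_finsuppSum] at hx
  have : B.repr x = 0 := by
    refine finsupp_eq_zero_of_sum_mul_eq_zero f g hg hc b b.linearIndependent _ ?_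
    rw [← hx]
    refine Finsupp.sum_congr fun i _ => ?_
    simp [B, TensorProduct.smul_tmul']
  simpa using this

theorem exists_of_commute_includeLeft [Algebra.IsCentral K D] (z : D ⊗[K] C)
    (hz : ∀ d : D, Commute (d ⊗ₜ[K] (1 : C)) z) : ∃ c : C, (1 : D) ⊗ₜ[K] c = z := by
  have hmem : z ∈ Subalgebra.centralizer K
      ((Algebra.TensorProduct.includeLeft : D →ₐ[K] D ⊗[K] C).range : Set (D ⊗[K] C)) := by
    rw [Subalgebra.mem_centralizer_iff]
    rintro _ ⟨d, rfl⟩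
    exact (hz d).eq
  rw [Subalgebra.centralizer_coe_range_includeLeft_eq_center_tensorProduct] at hmem
  clear hz
  obtain ⟨w, rfl⟩ := hmem
  induction w using TensorProduct.induction_on with
  | zero => exact ⟨0, by simp⟩
  | tmul x y =>
    obtain ⟨a, ha⟩ := Algebra.mem_bot.mp (Algebra.IsCentral.out x.2)
    refine ⟨a • y, ?_⟩
    simp [← ha, Algebra.algebraMap_eq_smul_one, TensorProduct.smul_tmul]
  | add x y hx hy =>
    obtain ⟨c, hc⟩ := hx
    obtain ⟨c', hc'⟩ := hy
    exact ⟨c + c', by rw [TensorProduct.tmul_add, hc, hc', map_add]⟩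

end Tensor

section TensorGalois
variable {K F L M : Type*} [Field K] [DivisionRing F] [Field L] [DivisionRing M] [Algebra K F]
  [Algebra K L]

/-- The action of the Galois group of `L/K` on the second factor of `F ⊗[K] L`. -/
noncomputable def tensorAut (e : F ⊗[K] L ≃+* M) :
    Gal(L/K) →* fixingAut (e.toRingHom.comp Algebra.TensorProduct.includeLeftRingHom) where
  toFun σ := ⟨(e.symm.trans
      (Algebra.TensorProduct.congr (AlgEquiv.refl : F ≃ₐ[K] F) σ).toRingEquiv).trans e, by
    intro x
    simp⟩
  map_one' := by
    ext x
    obtain ⟨y, rfl⟩ := e.surjective x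
    change e (Algebra.TensorProduct.congr _ 1 (e.symm (e y))) = e y
    rw [e.symm_apply_apply]
    congr 1
    induction y using TensorProduct.induction_on with
    | zero => simp
    | tmul d l => rfl
    | add x y hx hy => rw [map_add, hx, hy]
  map_mul' σ τ := by
    ext x
    obtain ⟨y, rfl⟩ := e.surjective x
    change e (Algebra.TensorProduct.congr _ _ (e.symm (e y))) =
      e (Algebra.TensorProduct.congr _ _ (e.symm (e
        (Algebra.TensorProduct.congr _ _ (e.symm (e y))))))
    simp only [e.symm_apply_apply]
    congr 1
    induction y using TensorProduct.induction_on with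
    | zero => simp
    | tmul d l => rfl
    | add x y hx hy => simp only [map_add, hx, hy]

theorem tensorAut_apply (e : F ⊗[K] L ≃+* M) (σ : Gal(L/K)) (x : F ⊗[K] L) :
    (tensorAut e σ : RingAut M) (e x) =
      e (Algebra.TensorProduct.congr (AlgEquiv.refl : F ≃ₐ[K] F) σ x) := by
  change e (Algebra.TensorProduct.congr _ _ (e.symm (e x))) = _
  rw [e.symm_apply_apply]

theorem tensorAut_bijective [Algebra.IsCentral K F] [FiniteDimensional K L]
    (e : F ⊗[K] L ≃+* M) : Function.Bijective (tensorAut e) := by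
  have hinj : Function.Injective (fun l : L => (1 : F) ⊗ₜ[K] l) :=
    Algebra.TensorProduct.includeRight_injective (FaithfulSMul.algebraMap_injective K F)
  constructor
  · intro σ τ h
    ext l
    have := congrArg (fun ρ : fixingAut _ => (ρ : RingAut M) (e (1 ⊗ₜ l))) h
    simp only [tensorAut_apply, EmbeddingLike.apply_eq_iff_eq] at this
    exact hinj (by simpa using this)
  · rintro ⟨τ, hτ⟩
    have hτ' : ∀ d : F, τ (e (d ⊗ₜ 1)) = e (d ⊗ₜ 1) := hτ
    have hex : ∀ l : L, ∃ l' : L, (1 : F) ⊗ₜ[K] l' = e.symm (τ (e (1 ⊗ₜ l))) := by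
      intro l
      apply exists_of_commute_includeLeft
      intro d
      apply e.injective
      rw [map_mul, map_mul, e.apply_symm_apply, ← hτ', ← map_mul, ← map_mul, ← map_mul, ← map_mul]
      simp
    choose s hs using hex
    have hs' : ∀ l, e (1 ⊗ₜ s l) = τ (e (1 ⊗ₜ l)) := fun l => by rw [hs]; simp
    have hinj' : Function.Injective (fun l : L => e ((1 : F) ⊗ₜ[K] l)) := e.injective.comp hinj
    have halg : ∀ a : K, (1 : F) ⊗ₜ[K] algebraMap K L a = algebraMap K F a ⊗ₜ 1 := fun a => by
      rw [Algebra.algebraMap_eq_smul_one, Algebra.algebraMap_eq_smul_one, TensorProduct.smul_tmul]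
    let φ : L →ₐ[K] L :=
      { toFun := s
        map_one' := hinj' <| by simp only [hs']; exact hτ' 1
        map_mul' := fun x y => hinj' <| by
          have : ∀ u v : L, (1 : F) ⊗ₜ[K] (u * v) = (1 ⊗ₜ u) * (1 ⊗ₜ v) := by simp
          simp only [hs', this, map_mul]
        map_zero' := hinj' <| by simp [hs']
        map_add' := fun x y => hinj' <| by
          simp only [hs', TensorProduct.tmul_add, map_add]
        commutes' := fun a => hinj' <| by
          simp only [hs', halg, hτ'] }
    refine ⟨AlgEquiv.ofBijective φ (Algebra.IsAlgebraic.algHom_bijective φ), ?_⟩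
    ext x
    obtain ⟨y, rfl⟩ := e.surjective x
    rw [tensorAut_apply]
    induction y using TensorProduct.induction_on with
    | zero => simp
    | tmul d l =>
      have : ∀ (d : F) (l : L), d ⊗ₜ[K] l = (d ⊗ₜ 1) * (1 ⊗ₜ l) := by simp
      simp only [Algebra.TensorProduct.congr_apply, Algebra.TensorProduct.map_tmul]
      rw [this, this d l, map_mul, map_mul, map_mul, hτ', ← hs']
      rfl
    | add x y hx hy => simp only [map_add, hx, hy]

theorem isGaloisExt_tensor [IsGalois K L] [FiniteDimensional K L] (e : F ⊗[K] L ≃+* M) :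
    IsGaloisExt (e.toRingHom.comp
      (Algebra.TensorProduct.includeLeftRingHom : F →+* F ⊗[K] L)) := by
  classical
  intro x hx
  obtain ⟨y, rfl⟩ := e.surjective x
  let b := Module.Basis.ofVectorSpace K F
  let E := TensorProduct.equivFinsuppOfBasisLeft (N := L) b
  have hnat : ∀ (σ : Gal(L/K)) (z : F ⊗[K] L) i,
      E (Algebra.TensorProduct.congr (AlgEquiv.refl : F ≃ₐ[K] F) σ z) i = σ (E z i) := by
    intro σ z i
    induction z using TensorProduct.induction_on with
    | zero => simp
    | tmul d l => simp [E]
    | add x y hx hy => simp only [map_add, Finsupp.add_apply, hx, hy]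
  have hfix : ∀ i, ∃ a : K, algebraMap K L a = E y i := by
    intro i
    have : E y i ∈ (⊥ : IntermediateField K L) := by
      rw [IsGalois.mem_bot_iff_fixed]
      intro σ
      have h := hx _ (tensorAut e σ).2
      rw [tensorAut_apply] at h
      rw [← hnat, e.injective h]
    exact IntermediateField.mem_bot.mp this
  choose a ha using hfix
  refine ⟨(E y).sum fun i _ => a i • b i, ?_⟩
  have hy : y = E.symm (E y) := (E.symm_apply_apply y).symm
  rw [TensorProduct.equivFinsuppOfBasisLeft_symm_apply b (E y)] at hy
  conv_rhs => rw [hy]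
  change e _ = e _
  congr 1
  simp only [Finsupp.sum, Algebra.TensorProduct.includeLeftRingHom_apply, TensorProduct.sum_tmul]
  refine Finset.sum_congr rfl fun i _ => ?_
  rw [← ha i, TensorProduct.smul_tmul, Algebra.algebraMap_eq_smul_one]

end TensorGalois

section SymmetricGroup
open Polynomial

theorem perm_range_eq_top_of_swap {G X : Type*} [Group G] [Finite X] [DecidableEq X]
    (ρ : G →* Equiv.Perm X) (x₀ : X)
    (htrans : ∀ y z, y ≠ x₀ → z ≠ x₀ → ∃ g, ρ g x₀ = x₀ ∧ ρ g y = z)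
    (hmove : ∃ g, ρ g x₀ ≠ x₀) (hswap : ∃ g, (ρ g).IsSwap) : ρ.range = ⊤ := by
  have hconj : ∀ (g : G) (a b : X), Equiv.swap a b ∈ ρ.range →
      Equiv.swap (ρ g a) (ρ g b) ∈ ρ.range := by
    intro g a b h
    rw [Equiv.swap_apply_apply]
    exact ρ.range.mul_mem (ρ.range.mul_mem ⟨g, rfl⟩ h) (ρ.range.inv_mem ⟨g, rfl⟩)
  have hto : ∀ y, ∃ g, ρ g y = x₀ := by
    intro y
    by_cases hy : y = x₀
    · exact ⟨1, by simp [hy]⟩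
    obtain ⟨g, hg⟩ := hmove
    obtain ⟨k, -, hk⟩ := htrans _ _ hg hy
    refine ⟨(k * g)⁻¹, ?_⟩
    rw [map_inv, Equiv.Perm.inv_eq_iff_eq, map_mul, Equiv.Perm.mul_apply, hk]
  obtain ⟨g, a, b, hab, hg⟩ := hswap
  have hbase : ∀ y, y ≠ x₀ → Equiv.swap x₀ y ∈ ρ.range := by
    intro y hy
    obtain ⟨p, hp⟩ := hto a
    have hb : ρ p b ≠ x₀ := by
      rw [← hp]; exact fun h => hab ((ρ p).injective h).symm
    obtain ⟨q, hq₁, hq₂⟩ := htrans _ _ hb hy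
    have h1 := hconj q _ _ (hconj p a b ⟨g, hg⟩)
    rwa [hp, hq₁, hq₂] at h1
  rw [eq_top_iff, ← Equiv.Perm.closure_isSwap, Subgroup.closure_le]
  rintro _ ⟨y, z, hyz, rfl⟩
  by_cases hy : y = x₀
  · subst hy; exact hbase z hyz.symm
  by_cases hz : z = x₀
  · subst hz; rw [Equiv.swap_comm]; exact hbase y hy
  obtain ⟨k, hk⟩ := hbase y hy
  have h1 := hconj k _ _ (hbase z hz)
  rwa [hk, Equiv.swap_apply_left, Equiv.swap_apply_of_ne_of_ne hz (Ne.symm hyz)] at h1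

theorem exists_gal_apply_eq {K L N Ω : Type*} [Field K] [Field L] [Field N] [Field Ω]
    [Algebra K L] [Algebra K N] [Algebra K Ω] [Algebra N Ω] [IsScalarTower K N Ω] [Normal K L]
    [Normal N Ω] (j : L →ₐ[K] Ω) (y z : L) (h : minpoly N (j y) = minpoly N (j z)) :
    ∃ g : Gal(L/K), g y = z ∧ ∀ x, j x ∈ Set.range (algebraMap N Ω) → g x = x := by
  let : Algebra L Ω := j.toRingHom.toAlgebra
  have : IsScalarTower K L Ω := IsScalarTower.of_algebraMap_eq fun a => (j.commutes a).symm
  obtain ⟨σ, hσ⟩ := (Normal.minpoly_eq_iff_mem_orbit Ω).mp h.symm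
  have hcomm : ∀ x, j ((σ.restrictScalars K).restrictNormal L x) = σ (j x) := fun x =>
    (σ.restrictScalars K).restrictNormal_commutes L x
  refine ⟨(σ.restrictScalars K).restrictNormal L, j.injective ?_, ?_⟩
  · change j _ = j _
    rw [hcomm]; exact hσ
  · rintro x ⟨a, ha⟩
    apply j.injective
    change j _ = j _
    rw [hcomm, ← ha, σ.commutes]

/-- The permutation of the roots of `P` in `L` induced by an automorphism of `L/K`. -/
def rootPerm {K L : Type*} [Field K] [Field L] [Algebra K L] (P : K[X]) :
    Gal(L/K) →* Equiv.Perm (P.rootSet L) where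
  toFun σ := σ.toEquiv.subtypeEquiv fun x => by
    simp only [mem_rootSet']
    simp [Polynomial.aeval_algHom_apply]
  map_one' := rfl
  map_mul' _ _ := rfl

theorem rootPerm_injective {K L : Type*} [Field K] [Field L] [Algebra K L] (P : K[X])
    [IsSplittingField K L P] : Function.Injective (rootPerm (L := L) P) := by
  intro σ τ h
  have : (σ : L →ₐ[K] L) = τ := AlgHom.ext_of_adjoin_eq_top
    (IsSplittingField.adjoin_rootSet L P) fun x hx => by
      have h1 := congrArg Subtype.val (DFunLike.congr_fun h (⟨x, hx⟩ : P.rootSet L))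
      exact h1
  ext x
  exact DFunLike.congr_fun this x

variable {K L : Type*} [Field K] [Field L] [Algebra K L] (P : K[X])

theorem exists_root_lift [IsSplittingField K L P] {Ω : Type*} [Field Ω] [Algebra K Ω]
    (hP : P ≠ 0) (j : L →ₐ[K] Ω) {w : Ω} (hw : aeval w P = 0) : ∃ x : P.rootSet L, j x = w := by
  have h := (IsSplittingField.splits L P).image_rootSet j
  have hmem : w ∈ P.rootSet Ω := mem_rootSet.mpr ⟨hP, hw⟩
  rw [← h] at hmem
  obtain ⟨x, hx, rfl⟩ := hmem
  exact ⟨⟨x, hx⟩, rfl⟩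

theorem exists_rootPerm_fix_transitive [IsSplittingField K L P] (hP : P ≠ 0)
    {N : Type*} [Field N] [Algebra K N] (r : N) (W : N[X]) (hW : Irreducible W)
    (hfac : P.map (algebraMap K N) = (X - C r) * W) :
    ∃ x₀ : P.rootSet L, ∀ y z, y ≠ x₀ → z ≠ x₀ →
      ∃ g : Gal(L/K), rootPerm P g x₀ = x₀ ∧ rootPerm P g y = z := by
  have : Normal K L := Normal.of_isSplittingField P
  let Ω := AlgebraicClosure N
  have hmap : P.map (algebraMap K Ω) = (X - C (algebraMap N Ω r)) * W.map (algebraMap N Ω) := by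
    rw [IsScalarTower.algebraMap_eq K N Ω, ← Polynomial.map_map, hfac]
    simp
  have hev : ∀ w : Ω, aeval w P = (w - algebraMap N Ω r) * aeval w W := by
    intro w
    rw [← eval_map_algebraMap, hmap, eval_mul, eval_map_algebraMap]
    simp
  let j : L →ₐ[K] Ω := IsSplittingField.lift L P (IsAlgClosed.splits _)
  obtain ⟨x₀, hx₀⟩ := exists_root_lift (L := L) P hP j (w := algebraMap N Ω r) (by simp [hev])
  refine ⟨x₀, fun y z hy hz => ?_⟩
  have hmin : ∀ y : P.rootSet L, y ≠ x₀ → minpoly N (j y) = W * C W.leadingCoeff⁻¹ := by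
    intro y hy
    have h0 : aeval (j y) P = 0 := by
      rw [Polynomial.aeval_algHom_apply, (mem_rootSet.mp y.2).2, map_zero]
    rw [hev, mul_eq_zero, sub_eq_zero, ← hx₀] at h0
    have h1 := h0.resolve_left fun h => hy (Subtype.ext (j.injective h))
    exact (minpoly.eq_of_irreducible hW h1).symm
  obtain ⟨g, hg, hfix⟩ := exists_gal_apply_eq (N := N) j (y : L) z
    ((hmin y hy).trans (hmin z hz).symm)
  exact ⟨g, Subtype.ext (hfix _ ⟨r, hx₀.symm⟩), Subtype.ext hg⟩

theorem exists_rootPerm_isSwap [DecidableEq (P.rootSet L)] [IsSplittingField K L P]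
    (hsep : P.Separable)
    {N : Type*} [Field N] [Algebra K N] (S : Finset N) (hcard : S.card + 2 = P.natDegree)
    (hroots : ∀ r ∈ S, aeval r P = 0) (hns : ¬ (P.map (algebraMap K N)).Splits) :
    ∃ g : Gal(L/K), (rootPerm P g).IsSwap := by
  classical
  have : Normal K L := Normal.of_isSplittingField P
  have hP : P ≠ 0 := hsep.ne_zero
  let Ω := AlgebraicClosure N
  let j : L →ₐ[K] Ω := IsSplittingField.lift L P (IsAlgClosed.splits _)
  have hroot : ∀ y : P.rootSet L, aeval (j y) P = 0 := by
    intro y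
    rw [Polynomial.aeval_algHom_apply, (mem_rootSet.mp y.2).2, map_zero]
  obtain ⟨y, hy⟩ : ∃ y : P.rootSet L, j y ∉ Set.range (algebraMap N Ω) := by
    by_contra! hall
    apply hns
    apply Splits.of_splits_map (algebraMap N Ω) (IsAlgClosed.splits _)
    intro a ha
    rw [Polynomial.map_map, ← IsScalarTower.algebraMap_eq K N Ω, mem_roots', IsRoot,
      eval_map_algebraMap] at ha
    obtain ⟨x, rfl⟩ := exists_root_lift (L := L) P hP j ha.2
    exact hall x
  have hintegral : ∀ x : P.rootSet L, IsIntegral N (j x) := fun x =>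
    (IsAlgebraic.tower_top N ⟨P, hP, hroot x⟩).isIntegral
  obtain ⟨z, hzy, hmin⟩ : ∃ z : P.rootSet L, z ≠ y ∧ minpoly N (j y) = minpoly N (j z) := by
    have hdvd : minpoly N (j y) ∣ P.map (algebraMap K N) :=
      minpoly.dvd _ _ (by rw [aeval_map_algebraMap, hroot])
    have hsep' : (minpoly N (j y)).Separable := hsep.map.of_dvd hdvd
    have hdeg := (minpoly.two_le_natDegree_iff (hintegral y)).mpr hy
    rw [← card_rootSet_eq_natDegree (K := Ω) hsep' (IsAlgClosed.splits _)] at hdeg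
    obtain ⟨⟨w, hw⟩, hwy⟩ := Fintype.exists_ne_of_one_lt_card hdeg
      (⟨j y, mem_rootSet.mpr ⟨hsep'.ne_zero, minpoly.aeval _ _⟩⟩ : (minpoly N (j y)).rootSet Ω)
    have hw0 := (mem_rootSet.mp hw).2
    obtain ⟨z, rfl⟩ := exists_root_lift (L := L) P hP j (w := w) (by
      rw [← aeval_map_algebraMap N]
      exact aeval_eq_zero_of_dvd_aeval_eq_zero hdvd hw0)
    refine ⟨z, fun h => hwy (by subst h; rfl), ?_⟩
    exact minpoly.eq_of_irreducible_of_monic (minpoly.irreducible (hintegral y)) hw0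
      (minpoly.monic (hintegral y))
  obtain ⟨g, hg, hfix⟩ := exists_gal_apply_eq (N := N) j (y : L) z hmin
  have hz : j z ∉ Set.range (algebraMap N Ω) := by
    have h1 := (minpoly.two_le_natDegree_iff (hintegral y)).mpr hy
    rw [hmin] at h1
    exact (minpoly.two_le_natDegree_iff (hintegral z)).mp h1
  have hothers : ∀ x : P.rootSet L, x ≠ y → x ≠ z → j x ∈ Set.range (algebraMap N Ω) := by
    intro x hxy hxz
    by_contra hx
    have hlift : ∀ s : S, ∃ x : P.rootSet L, j x = algebraMap N Ω s := fun s =>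
      exists_root_lift P hP j (by rw [aeval_algebraMap_apply, hroots s s.2, map_zero])
    choose t ht using hlift
    have hinj : Function.Injective t := fun s s' h => by
      apply Subtype.ext
      apply (algebraMap N Ω).injective
      rw [← ht, ← ht, h]
    have hdisj : Disjoint (Finset.univ.image t) {x, y, z} := by
      rw [Finset.disjoint_left]
      intro a ha
      obtain ⟨s, -, rfl⟩ := Finset.mem_image.mp ha
      have hs : j (t s) ∈ Set.range (algebraMap N Ω) := ⟨s, (ht s).symm⟩
      simp only [Finset.mem_insert, Finset.mem_singleton]
      rintro (h | h | h) <;> rw [h] at hs <;> contradiction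
    have hc := Finset.card_le_univ (Finset.univ.image t ∪ {x, y, z})
    rw [Finset.card_union_of_disjoint hdisj, Finset.card_image_of_injective _ hinj,
      Finset.card_eq_three.mpr ⟨x, y, z, hxy, hxz, hzy.symm, rfl⟩, Finset.card_univ,
      Fintype.card_coe, card_rootSet_eq_natDegree hsep (IsSplittingField.splits L P)] at hc
    omega
  refine ⟨g, y, z, hzy.symm, ?_⟩
  have hgy : rootPerm P g y = z := Subtype.ext hg
  have hgx : ∀ x, x ≠ y → x ≠ z → rootPerm P g x = x := fun x h₁ h₂ =>
    Subtype.ext (hfix _ (hothers x h₁ h₂))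
  ext1 x
  rcases eq_or_ne x y with rfl | hxy
  · rw [hgy, Equiv.swap_apply_left]
  rcases eq_or_ne x z with rfl | hxz
  · rw [Equiv.swap_apply_right]
    by_contra hne
    have hne' : rootPerm P g x ≠ x := fun h => hzy ((rootPerm P g).injective (h.trans hgy.symm))
    exact hne' ((rootPerm P g).injective (hgx _ hne hne'))
  · rw [hgx x hxy hxz, Equiv.swap_apply_of_ne_of_ne hxy hxz]

theorem nonempty_gal_mulEquiv_perm [IsSplittingField K L P] (hsep : P.Separable)
    (hnoroot : ∀ a : K, ¬ P.IsRoot a)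
    {N : Type*} [Field N] (ψ : K →+* N) (r : N) (W : N[X]) (hW : Irreducible W)
    (hfac : P.map ψ = (X - C r) * W)
    {N' : Type*} [Field N'] (ψ' : K →+* N') (S : Finset N') (hcard : S.card + 2 = P.natDegree)
    (hroots : ∀ r ∈ S, (P.map ψ').eval r = 0) (hns : ¬ (P.map ψ').Splits) :
    Nonempty (Gal(L/K) ≃* Equiv.Perm (Fin P.natDegree)) := by
  classical
  let : Algebra K N := ψ.toAlgebra
  let : Algebra K N' := ψ'.toAlgebra
  have hP : P ≠ 0 := hsep.ne_zero
  have : IsGalois K L := IsGalois.of_separable_splitting_field hsep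
  have : FiniteDimensional K L := IsSplittingField.finiteDimensional L P
  obtain ⟨x₀, htrans⟩ := exists_rootPerm_fix_transitive (L := L) P hP r W hW hfac
  have hmove : ∃ g : Gal(L/K), rootPerm P g x₀ ≠ x₀ := by
    by_contra! hall
    have : (x₀ : L) ∈ (⊥ : IntermediateField K L) := by
      rw [IsGalois.mem_bot_iff_fixed]
      exact fun g => congrArg Subtype.val (hall g)
    obtain ⟨a, ha⟩ := IntermediateField.mem_bot.mp this
    apply hnoroot a
    have h0 := (mem_rootSet.mp x₀.2).2
    rw [← ha, aeval_algebraMap_apply] at h0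
    simpa [IsRoot] using h0
  have hrange := perm_range_eq_top_of_swap (rootPerm P) x₀ htrans hmove
    (exists_rootPerm_isSwap P hsep S hcard (fun r hr => by
      rw [aeval_def, ← eval_map]; exact hroots r hr) hns)
  have e₁ := MulEquiv.ofBijective (rootPerm (L := L) P)
    ⟨rootPerm_injective P, MonoidHom.range_eq_top.mp hrange⟩
  have hc : Fintype.card (P.rootSet L) = Fintype.card (Fin P.natDegree) := by
    rw [Fintype.card_fin, card_rootSet_eq_natDegree hsep (IsSplittingField.splits L P)]
  exact ⟨e₁.trans (Fintype.equivOfCardEq hc).permCongrHom⟩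

end SymmetricGroup

section Pencil
open Polynomial

/-- The polynomial `(1 - u) f + u h`. -/
noncomputable def pencil {k B : Type*} [Field k] [CommRing B] [Algebra k B] (f h : k[X]) (u : B) :
    B[X] :=
  C (1 - u) * f.map (algebraMap k B) + C u * h.map (algebraMap k B)

theorem pencil_map {k B B' : Type*} [Field k] [CommRing B] [Algebra k B] [CommRing B']
    [Algebra k B'] (f h : k[X]) (u : B) (ψ : B →+* B')
    (hψ : ψ.comp (algebraMap k B) = algebraMap k B') :
    (pencil f h u).map ψ = pencil f h (ψ u) := by
  simp [pencil, Polynomial.map_map, hψ]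

theorem pencil_eval {k B : Type*} [Field k] [CommRing B] [Algebra k B] (f h : k[X]) (u y : B) :
    (pencil f h u).eval y = (1 - u) * aeval y f + u * aeval y h := by
  simp [pencil, eval_map_algebraMap]

theorem pencil_monic_natDegree {k B : Type*} [Field k] [CommRing B] [Nontrivial B] [Algebra k B]
    {f h : k[X]} (hf : f.Monic) (hh : h.Monic) (hdeg : f.natDegree = h.natDegree) (u : B) :
    (pencil f h u).Monic ∧ (pencil f h u).natDegree = h.natDegree := by
  have hle : (pencil f h u).natDegree ≤ h.natDegree := by
    refine (natDegree_add_le _ _).trans (max_le ?_ ?_)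
    · exact (natDegree_C_mul_le _ _).trans (natDegree_map_le.trans hdeg.le)
    · exact (natDegree_C_mul_le _ _).trans natDegree_map_le
  have hcoeff : (pencil f h u).coeff h.natDegree = 1 := by
    have h1 : f.coeff h.natDegree = 1 := by rw [← hdeg]; exact hf
    have h2 : h.coeff h.natDegree = 1 := hh
    simp only [pencil, coeff_add, coeff_C_mul, coeff_map, h1, h2, map_one]
    ring
  exact ⟨monic_of_natDegree_le_of_coeff_eq_one _ hle hcoeff,
    natDegree_eq_of_le_of_coeff_ne_zero hle (by rw [hcoeff]; exact one_ne_zero)⟩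

/-- If `P` has no root and factors over an extension as a linear factor times an irreducible
polynomial, then `P` is irreducible. -/
theorem irreducible_of_map_eq_linear_mul {K N : Type*} [Field K] [Field N] (ψ : K →+* N)
    {P : K[X]} (hnoroot : ∀ a, ¬ P.IsRoot a) (hP : 0 < P.natDegree) {r : N} {W : N[X]}
    (hW : Irreducible W) (hfac : P.map ψ = (X - C r) * W) : Irreducible P := by
  have key : ∀ p q : K[X], P = p * q → (X - C r) ∣ p.map ψ → IsUnit q := by
    rintro p q hpq ⟨p', hp'⟩
    have h1 : W = p' * q.map ψ := by
      apply mul_left_cancel₀ (X_sub_C_ne_zero r)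
      rw [← hfac, hpq, Polynomial.map_mul, hp', mul_assoc]
    rcases hW.isUnit_or_isUnit h1 with h2 | h2
    · have hdeg : p.degree = 1 := by
        rw [← degree_map p ψ, hp', degree_mul, degree_X_sub_C, degree_eq_zero_of_isUnit h2,
          add_zero]
      obtain ⟨a, ha⟩ := exists_root_of_degree_eq_one hdeg
      exact absurd (by rw [hpq]; exact root_mul_right_of_isRoot _ ha) (hnoroot a)
    · exact (isUnit_map ψ).mp h2
  refine ⟨fun h => hP.ne' (natDegree_eq_zero_of_isUnit h), fun p q hpq => ?_⟩
  have hdvd : (X - C r) ∣ p.map ψ * q.map ψ := by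
    rw [← Polynomial.map_mul, ← hpq, hfac]; exact dvd_mul_right _ _
  rcases (prime_X_sub_C r).dvd_or_dvd hdvd with h | h
  · exact Or.inr (key p q hpq h)
  · exact Or.inl (key q p (by rw [hpq, mul_comm]) h)

section Local
variable {E : Type*} [Field E]

theorem exists_powerSeries_root_of_simple_root (G : (PowerSeries E)[X]) (hG : G.Monic) (b : E)
    (h0 : (G.map PowerSeries.constantCoeff).eval b = 0)
    (h1 : (G.map PowerSeries.constantCoeff).derivative.eval b ≠ 0) :
    ∃ r : PowerSeries E, G.eval r = 0 ∧ PowerSeries.constantCoeff r = b := by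
  have hb : (PowerSeries.constantCoeff (R := E)) (PowerSeries.C b) = b := by simp
  obtain ⟨r, hr, hrb⟩ := (IsAdicComplete.henselianRing (PowerSeries E)
    (Ideal.span {PowerSeries.X})).is_henselian G hG (PowerSeries.C b) (by
      rw [Ideal.mem_span_singleton, PowerSeries.X_dvd_iff, ← h0,
        ← hb, eval_map, eval₂_at_apply, hb]) (by
      apply IsUnit.map
      rw [PowerSeries.isUnit_iff_constantCoeff, isUnit_iff_ne_zero]
      rwa [derivative_map, ← hb, eval_map, eval₂_at_apply] at h1)
  refine ⟨r, hr, ?_⟩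
  rw [Ideal.mem_span_singleton, PowerSeries.X_dvd_iff, map_sub, hb, sub_eq_zero] at hrb
  exact hrb

theorem eq_zero_of_aeval_powerSeries_eq_zero {w : PowerSeries E} (hw : w ≠ 0)
    (hw0 : PowerSeries.constantCoeff w = 0) {q : E[X]} (hq : aeval w q = 0) : q = 0 := by
  by_contra hne
  have hintegral : IsIntegral E w := IsAlgebraic.isIntegral ⟨q, hne, hq⟩
  apply hw
  rw [← minpoly.coeff_zero_eq_zero hintegral]
  have h := congrArg PowerSeries.constantCoeff (minpoly.aeval E w)
  have h2 : PowerSeries.constantCoeff (aeval w (minpoly E w)) =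
      (minpoly E w).eval (PowerSeries.constantCoeff w) := by
    rw [aeval_def, hom_eval₂, eval, hw0]
    congr 1
  rw [h2, hw0, map_zero, ← coeff_zero_eq_eval_zero] at h
  exact h

theorem eval₂_powerSeries_injective {A : Type*} [CommRing A] (ι : A →+* E)
    (hι : Function.Injective ι) (b : E) {w : PowerSeries E} (hw : w ≠ 0)
    (hw0 : PowerSeries.constantCoeff w = 0) :
    Function.Injective (eval₂RingHom (PowerSeries.C.comp ι) (PowerSeries.C b + w)) := by
  rw [injective_iff_map_eq_zero]
  intro p hp
  have h1 : aeval w ((p.map ι).comp (X + C b)) = 0 := by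
    rw [aeval_comp, ← hp]
    simp [aeval_def, eval₂_map, add_comm]
  have h2 := eq_zero_of_aeval_powerSeries_eq_zero hw hw0 h1
  rw [comp_X_add_C_eq_zero_iff, ← Polynomial.map_zero ι] at h2
  exact map_injective ι hι h2

variable {k : Type*} [Field k] [Algebra k E]

theorem pencil_map_constantCoeff (f h : k[X]) (u : PowerSeries E) :
    (pencil f h u).map PowerSeries.constantCoeff = pencil f h (PowerSeries.constantCoeff u) :=
  pencil_map f h u _ (by ext; simp [PowerSeries.algebraMap_apply])

theorem constantCoeff_aeval (f : k[X]) (y : PowerSeries E) :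
    PowerSeries.constantCoeff (aeval y f) = aeval (PowerSeries.constantCoeff y) f := by
  rw [aeval_def, hom_eval₂, aeval_def]
  congr 1

/-- A pencil degenerating to `X ^ d * (X - c)` is a linear factor times an Eisenstein polynomial. -/
theorem exists_pencil_eq_linear_mul_irreducible {d : ℕ} (hd : d ≠ 0) {c : k} (hc : c ≠ 0) {h : k[X]}
    (hh : h.Monic) (hdeg : h.natDegree = d + 1) (h0 : h.eval 0 ≠ 0) :
    ∃ (r : PowerSeries E) (W : (PowerSeries E)[X]), W.Monic ∧ Irreducible W ∧
      pencil (X ^ d * (X - C c)) h (PowerSeries.X : PowerSeries E) = (X - C r) * W ∧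
      (pencil (X ^ d * (X - C c)) h (PowerSeries.X : PowerSeries E)).derivative.eval r ≠ 0 := by
  set f : k[X] := X ^ d * (X - C c) with hf
  have hfm : f.Monic := (monic_X_pow d).mul (monic_X_sub_C c)
  have hfd : f.natDegree = h.natDegree := by
    rw [hdeg, hf, (monic_X_pow d).natDegree_mul (monic_X_sub_C c)]; simp
  set G := pencil f h (PowerSeries.X : PowerSeries E) with hG
  have hGm : G.Monic := (pencil_monic_natDegree hfm hh hfd _).1
  have hGred : G.map PowerSeries.constantCoeff = X ^ d * (X - C (algebraMap k E c)) := by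
    rw [hG, pencil_map_constantCoeff]
    simp [pencil, hf]
  have hc' : algebraMap k E c ≠ 0 := by simpa using hc
  have hder : (G.map PowerSeries.constantCoeff).derivative.eval (algebraMap k E c) ≠ 0 := by
    rw [hGred]; simp [hc]
  obtain ⟨r, hr, hrc⟩ := exists_powerSeries_root_of_simple_root G hGm (algebraMap k E c)
    (by rw [hGred]; simp) hder
  obtain ⟨W, hW⟩ := dvd_iff_isRoot.mpr hr
  have hWm : W.Monic := (monic_X_sub_C r).of_mul_monic_left (hW ▸ hGm)
  have hWred : W.map PowerSeries.constantCoeff = X ^ d := by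
    apply mul_left_cancel₀ (X_sub_C_ne_zero (algebraMap k E c))
    rw [mul_comm _ (X ^ d), ← hGred, hW]
    simp [hrc]
  have hWd : W.natDegree = d := by
    rw [← hWm.natDegree_map PowerSeries.constantCoeff, hWred, natDegree_X_pow]
  have hspan : (Ideal.span {(PowerSeries.X : PowerSeries E)}).IsPrime :=
    (Ideal.span_singleton_prime PowerSeries.X_ne_zero).mpr PowerSeries.X_prime
  refine ⟨r, W, hWm, ?_, hW, fun h1 => hder ?_⟩
  · refine IsEisensteinAt.irreducible (𝓟 := Ideal.span {PowerSeries.X}) ⟨?_, ?_, ?_⟩ hspan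
      hWm.isPrimitive (by omega)
    · rw [hWm.leadingCoeff]
      exact (Ideal.ne_top_iff_one _).mp hspan.ne_top
    · intro n hn
      rw [Ideal.mem_span_singleton, PowerSeries.X_dvd_iff, ← coeff_map, hWred, coeff_X_pow,
        if_neg (by omega)]
    · rw [Ideal.span_singleton_pow, Ideal.mem_span_singleton]
      intro hdvd
      have h1 : PowerSeries.X * algebraMap k (PowerSeries E) (h.eval 0) = -r * W.coeff 0 := by
        have h2 : aeval (0 : PowerSeries E) h = algebraMap k (PowerSeries E) (h.eval 0) := by
          rw [← map_zero (algebraMap k (PowerSeries E)), aeval_algebraMap_apply]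
          simp
        have h3 := congrArg (eval 0) hW
        rw [hG, pencil_eval, h2] at h3
        simpa [hf, hd, coeff_zero_eq_eval_zero] using h3
      have h2 := h1 ▸ hdvd.mul_left (-r)
      rw [sq, mul_dvd_mul_iff_left PowerSeries.X_ne_zero, PowerSeries.X_dvd_iff,
        PowerSeries.algebraMap_apply] at h2
      simp [h0] at h2
  · rw [derivative_map, ← hrc, eval_map, eval₂_at_apply, h1, map_zero]

theorem exists_finset_roots_pencil {f h : k[X]} (hf : f.Monic) (hh : h.Monic)
    (hdeg : f.natDegree = h.natDegree) (T : Finset k) (hT : ∀ i ∈ T, h.eval i = 0)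
    (hT' : ∀ i ∈ T, h.derivative.eval i ≠ 0) (u : PowerSeries E)
    (hu : PowerSeries.constantCoeff u = 1) :
    ∃ S : Finset (PowerSeries E), S.card = T.card ∧ ∀ r ∈ S, (pencil f h u).eval r = 0 ∧
      ∃ i ∈ T, PowerSeries.constantCoeff r = algebraMap k E i := by
  classical
  have hred : (pencil f h u).map PowerSeries.constantCoeff = h.map (algebraMap k E) := by
    rw [pencil_map_constantCoeff, hu]
    simp [pencil]
  have hex : ∀ i : T, ∃ r : PowerSeries E, (pencil f h u).eval r = 0 ∧
      PowerSeries.constantCoeff r = algebraMap k E i := by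
    intro i
    apply exists_powerSeries_root_of_simple_root _ (pencil_monic_natDegree hf hh hdeg u).1
    · rw [hred, eval_map, eval₂_at_apply, hT i i.2, map_zero]
    · rw [hred, derivative_map, eval_map, eval₂_at_apply]
      simpa using hT' i i.2
  choose r hr hri using hex
  have hinj : Function.Injective r := fun i j hij => by
    apply Subtype.ext
    apply (algebraMap k E).injective
    rw [← hri, ← hri, hij]
  refine ⟨Finset.univ.image r, ?_, fun s hs => ?_⟩
  · rw [Finset.card_image_of_injective _ hinj, Finset.card_univ, Fintype.card_coe]
  · obtain ⟨i, -, rfl⟩ := Finset.mem_image.mp hs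
    exact ⟨hr i, i, i.2, hri i⟩

theorem not_splits_pencil {f g : k[X]} {a : k} (hf : f.Monic) (hh : ((X - C a) ^ 2 * g).Monic)
    (hdeg : f.natDegree = ((X - C a) ^ 2 * g).natDegree) (hfa : f.eval a ≠ 0) :
    ¬ ((pencil f ((X - C a) ^ 2 * g) (1 + PowerSeries.X : PowerSeries E)).map
      (algebraMap (PowerSeries E) (LaurentSeries E))).Splits := by
  set h := (X - C a) ^ 2 * g with hhdef
  set G := pencil f h (1 + PowerSeries.X : PowerSeries E) with hG
  have hGm : G.Monic := (pencil_monic_natDegree hf hh hdeg _).1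
  intro hs
  have hs' : G.Splits := Splits.of_splits_map_of_injective
    (IsFractionRing.injective (PowerSeries E) (LaurentSeries E)) hs fun y hy => by
      have hintegral : IsIntegral (PowerSeries E) y :=
        ⟨G, hGm, by rw [← eval_map]; exact (mem_roots'.mp hy).2⟩
      exact IsIntegrallyClosed.isIntegral_iff.mp hintegral
  have hred : G.map PowerSeries.constantCoeff = h.map (algebraMap k E) := by
    rw [hG, pencil_map_constantCoeff]
    simp [pencil]
  have hroot : (G.map PowerSeries.constantCoeff).eval (algebraMap k E a) = 0 := by
    rw [hred, eval_map, eval₂_at_apply, hhdef]; simp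
  rw [hs'.eq_prod_roots_of_monic hGm, Polynomial.map_multiset_prod, eval_multiset_prod,
    Multiset.prod_eq_zero_iff] at hroot
  simp only [Multiset.map_map, Multiset.mem_map, Function.comp_apply, Polynomial.map_sub, map_X,
    map_C, eval_sub, eval_X, eval_C, sub_eq_zero] at hroot
  obtain ⟨y, hy, hya⟩ := hroot
  have hy0 : G.eval y = 0 := (mem_roots'.mp hy).2
  have hdvd : PowerSeries.X ∣ y - algebraMap k (PowerSeries E) a := by
    rw [PowerSeries.X_dvd_iff, PowerSeries.algebraMap_apply]
    simp [hya]
  obtain ⟨z, hz⟩ := hdvd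
  have h1 : PowerSeries.X * aeval y f =
      PowerSeries.X * (PowerSeries.X * (z ^ 2 * aeval y g * (1 + PowerSeries.X))) := by
    rw [hG, pencil_eval, hhdef] at hy0
    simp only [map_mul, map_pow, map_sub, aeval_X, aeval_C, hz] at hy0
    linear_combination (-1 : PowerSeries E) * hy0
  have h2 := congrArg PowerSeries.constantCoeff (mul_left_cancel₀ PowerSeries.X_ne_zero h1)
  rw [constantCoeff_aeval, ← hya, aeval_algebraMap_apply] at h2
  simp [hfa] at h2

theorem exists_splits_pencil {f g : k[X]} {a : k} (hf : f.Monic) (hh : ((X - C a) ^ 2 * g).Monic)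
    (hdeg : f.natDegree = ((X - C a) ^ 2 * g).natDegree) (hfa : f.eval a ≠ 0)
    (T : Finset k) (hT : ∀ i ∈ T, ((X - C a) ^ 2 * g).eval i = 0)
    (hT' : ∀ i ∈ T, ((X - C a) ^ 2 * g).derivative.eval i ≠ 0)
    (hcard : T.card + 2 = ((X - C a) ^ 2 * g).natDegree) :
    ∃ w : PowerSeries E, w ≠ 0 ∧ PowerSeries.constantCoeff w = 0 ∧
      ((pencil f ((X - C a) ^ 2 * g) (1 + w)).map
        (algebraMap (PowerSeries E) (LaurentSeries E))).Splits := by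
  classical
  set h := (X - C a) ^ 2 * g with hhdef
  set y : PowerSeries E := algebraMap k (PowerSeries E) a + PowerSeries.X with hy
  have hya : PowerSeries.constantCoeff y = algebraMap k E a := by
    simp [hy, PowerSeries.algebraMap_apply]
  have hfy : PowerSeries.constantCoeff (aeval y f) ≠ 0 := by
    rw [constantCoeff_aeval, hya, aeval_algebraMap_apply]
    simpa using hfa
  have hhy : PowerSeries.constantCoeff (aeval y h) = 0 := by
    rw [constantCoeff_aeval, hya, aeval_algebraMap_apply, hhdef]
    simp
  have hden : PowerSeries.constantCoeff (aeval y f - aeval y h) ≠ 0 := by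
    rw [map_sub, hhy, sub_zero]; exact hfy
  have hinv := PowerSeries.mul_inv_cancel _ hden
  set w := aeval y h * (aeval y f - aeval y h)⁻¹ with hw
  have hw0 : PowerSeries.constantCoeff w = 0 := by rw [hw, map_mul, hhy, zero_mul]
  have hroot : (pencil f h (1 + w)).eval y = 0 := by
    rw [pencil_eval, hw]
    linear_combination (-aeval y h) * hinv
  have hwne : w ≠ 0 := by
    apply mul_ne_zero _ (right_ne_zero_of_mul_eq_one hinv)
    intro h0
    have h1 : aeval (PowerSeries.X : PowerSeries E)
        ((h.map (algebraMap k E)).comp (X + C (algebraMap k E a))) = 0 := by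
      rw [aeval_comp, aeval_map_algebraMap, ← h0, hy, add_comm]
      simp [PowerSeries.algebraMap_apply]
    have h2 := eq_zero_of_aeval_powerSeries_eq_zero PowerSeries.X_ne_zero (by simp) h1
    rw [comp_X_add_C_eq_zero_iff, Polynomial.map_eq_zero] at h2
    exact hh.ne_zero h2
  refine ⟨w, hwne, hw0, ?_⟩
  obtain ⟨S, hS, hSr⟩ := exists_finset_roots_pencil hf hh hdeg T hT hT' (1 + w) (by simp [hw0])
  have hyS : y ∉ S := by
    intro hyS
    obtain ⟨-, i, hi, hyi⟩ := hSr y hyS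
    rw [hya] at hyi
    have hai := (algebraMap k E).injective hyi
    apply hT' i hi
    rw [← hai, hhdef]
    simp [derivative_pow]
  set G := pencil f h (1 + w) with hG
  have hGm := pencil_monic_natDegree hf hh hdeg (1 + w)
  rw [← hG] at hGm
  have hinj := IsFractionRing.injective (PowerSeries E) (LaurentSeries E)
  have hG0 : G.map (algebraMap (PowerSeries E) (LaurentSeries E)) ≠ 0 := (hGm.1.map _).ne_zero
  have hcardroots : h.natDegree - 1 ≤
      (G.map (algebraMap (PowerSeries E) (LaurentSeries E))).roots.card := by
    have hsub : ((insert y S).image (algebraMap (PowerSeries E) (LaurentSeries E))).val ⊆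
        (G.map (algebraMap (PowerSeries E) (LaurentSeries E))).roots := by
      intro z hz
      obtain ⟨r, hr, rfl⟩ := Finset.mem_image.mp hz
      rw [mem_roots hG0, IsRoot, eval_map, eval₂_at_apply]
      rcases Finset.mem_insert.mp hr with rfl | hr
      · rw [hroot, map_zero]
      · rw [(hSr r hr).1, map_zero]
    have := Multiset.card_le_card ((Multiset.le_iff_subset (Finset.nodup _)).mpr hsub)
    rw [Finset.card_val, Finset.card_image_of_injective _ hinj, Finset.card_insert_of_notMem hyS,
      hS] at this
    omega
  obtain ⟨q, hq, hqd, -⟩ := exists_prod_multiset_X_sub_C_mul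
    (G.map (algebraMap (PowerSeries E) (LaurentSeries E)))
  rw [← hq]
  refine Splits.mul (Splits.multisetProd ?_) (Splits.of_natDegree_le_one ?_)
  · intro p hp
    obtain ⟨z, -, rfl⟩ := Multiset.mem_map.mp hp
    exact Splits.X_sub_C z
  · rw [hGm.1.natDegree_map, hGm.2] at hqd
    omega

end Local

section Global
variable {k A K : Type*} [Field k] [CommRing A] [Algebra k A] [Field K]
  [Algebra A[X] K] [IsFractionRing A[X] K]

theorem not_isRoot_pencil [IsDomain A] [UniqueFactorizationMonoid A] {d : ℕ} (hd : 2 ≤ d) {c : k}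
    {h : k[X]} (hh : h.Monic) (hdeg : h.natDegree = d + 1)
    (hcop : IsCoprime (X ^ d * (X - C c)) h) (b : K) :
    ¬ ((pencil (X ^ d * (X - C c)) h (X : A[X])).map (algebraMap A[X] K)).IsRoot b := by
  intro hb
  set f : k[X] := X ^ d * (X - C c) with hf
  have hfm : f.Monic := (monic_X_pow d).mul (monic_X_sub_C c)
  have hfd : f.natDegree = h.natDegree := by
    rw [hdeg, hf, (monic_X_pow d).natDegree_mul (monic_X_sub_C c)]; simp
  have hintegral : IsIntegral A[X] b :=
    ⟨_, (pencil_monic_natDegree hfm hh hfd (X : A[X])).1, by rw [← eval_map]; exact hb⟩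
  obtain ⟨r, rfl⟩ := IsIntegrallyClosed.isIntegral_iff.mp hintegral
  rw [IsRoot, eval_map, eval₂_at_apply, map_eq_zero_iff _ (IsFractionRing.injective A[X] K),
    pencil_eval] at hb
  have hcop' : IsCoprime (aeval r f) (aeval r h) := hcop.map (aeval r).toRingHom
  have hdvd : aeval r f ∣ X := by
    apply hcop'.dvd_of_dvd_mul_right
    exact ⟨-(1 - X), by linear_combination hb⟩
  have hr : IsUnit r := by
    have h1 : r * r ∣ X := by
      refine dvd_trans ?_ hdvd
      rw [hf, map_mul, map_pow, aeval_X, ← sq]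
      exact (pow_dvd_pow r hd).mul_right _
    obtain ⟨q, hq⟩ := h1
    rw [mul_assoc] at hq
    rcases (irreducible_X (R := A)).isUnit_or_isUnit hq with h2 | h2
    · exact h2
    · exact isUnit_of_mul_isUnit_left h2
  obtain ⟨a, -, rfl⟩ := isUnit_iff.mp hr
  have hC : ∀ p : k[X], aeval (C a : A[X]) p = C (aeval a p) := fun p =>
    aeval_algebraMap_apply A[X] a p
  rw [hC, hC] at hb
  have hb' : C (aeval a f) + X * C (aeval a h - aeval a f) = 0 := by
    rw [map_sub]; linear_combination hb
  have h0 : aeval a f = 0 := by simpa using congrArg (coeff · 0) hb'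
  have h1 : aeval a h = 0 := by simpa [h0] using congrArg (coeff · 1) hb'
  have hcop₂ : IsCoprime (aeval a f) (aeval a h) := hcop.map (aeval a).toRingHom
  rw [h0, h1, isCoprime_zero_left] at hcop₂
  exact not_isUnit_zero hcop₂

variable {E : Type*} [Field E] [Algebra k E]

theorem exists_ringHom_laurentSeries (ι : A →ₐ[k] E) (hι : Function.Injective ι) (f h : k[X])
    (b : k) {w : PowerSeries E} (hw : w ≠ 0) (hw0 : PowerSeries.constantCoeff w = 0) :
    ∃ ψ : K →+* LaurentSeries E,
      (∀ x : k, ψ (algebraMap A[X] K (algebraMap k A[X] x)) =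
        algebraMap (PowerSeries E) (LaurentSeries E) (algebraMap k (PowerSeries E) x)) ∧
      ((pencil f h (X : A[X])).map (algebraMap A[X] K)).map ψ =
        (pencil f h (algebraMap k (PowerSeries E) b + w)).map
          (algebraMap (PowerSeries E) (LaurentSeries E)) := by
  set σ := eval₂RingHom (PowerSeries.C.comp (ι : A →+* E))
    (PowerSeries.C (algebraMap k E b) + w) with hσ
  have hσi : Function.Injective σ := eval₂_powerSeries_injective (ι : A →+* E) hι _ hw hw0
  have hσk : σ.comp (algebraMap k A[X]) = algebraMap k (PowerSeries E) := by
    ext1 x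
    simp [hσ, PowerSeries.algebraMap_apply, Polynomial.algebraMap_apply]
  have hinj : Function.Injective ((algebraMap (PowerSeries E) (LaurentSeries E)).comp σ) :=
    (IsFractionRing.injective (PowerSeries E) (LaurentSeries E)).comp hσi
  have hlift : (IsFractionRing.lift hinj : K →+* LaurentSeries E).comp (algebraMap A[X] K) =
      (algebraMap (PowerSeries E) (LaurentSeries E)).comp σ :=
    RingHom.ext fun p => by rw [RingHom.comp_apply, IsFractionRing.lift_algebraMap]
  refine ⟨IsFractionRing.lift hinj, fun x => ?_, ?_⟩
  · rw [IsFractionRing.lift_algebraMap, RingHom.comp_apply, ← hσk, RingHom.comp_apply]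
  · rw [Polynomial.map_map, hlift, ← Polynomial.map_map, pencil_map _ _ _ _ hσk]
    simp [hσ, PowerSeries.algebraMap_apply]

theorem exists_finset_simple_roots [Infinite k] {m : ℕ} (hm : 3 ≤ m) :
    ∃ (c a : k) (g : k[X]) (T : Finset k), c ≠ 0 ∧ ((X - C a) ^ 2 * g).Monic ∧
      ((X - C a) ^ 2 * g).natDegree = m ∧ T.card + 2 = m ∧
      (∀ i ∈ T, ((X - C a) ^ 2 * g).eval i = 0) ∧
      (∀ i ∈ T, ((X - C a) ^ 2 * g).derivative.eval i ≠ 0) ∧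
      IsCoprime (X ^ (m - 1) * (X - C c)) ((X - C a) ^ 2 * g) := by
  classical
  obtain ⟨U, hU, hUc⟩ := Infinite.exists_superset_card_eq ({0} : Finset k) (m + 1) (by simp)
  rw [Finset.singleton_subset_iff] at hU
  have h1 := Finset.card_erase_of_mem hU
  obtain ⟨c, hc⟩ : (U.erase 0).Nonempty := Finset.card_pos.mp (by omega)
  have h2 := Finset.card_erase_of_mem hc
  obtain ⟨a, ha⟩ : ((U.erase 0).erase c).Nonempty := Finset.card_pos.mp (by omega)
  have h3 := Finset.card_erase_of_mem ha
  set T := ((U.erase 0).erase c).erase a with hT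
  have hT0 : ∀ i ∈ T, i ≠ 0 ∧ i ≠ c ∧ i ≠ a := by
    intro i hi
    simp only [hT, Finset.mem_erase] at hi
    tauto
  have hc0 : c ≠ 0 := (Finset.mem_erase.mp hc).1
  have hac : a ≠ c := (Finset.mem_erase.mp ha).1
  have ha0 : a ≠ 0 := (Finset.mem_erase.mp (Finset.mem_erase.mp ha).2).1
  have hgm : (∏ i ∈ T, (X - C i)).Monic := monic_prod_X_sub_C id T
  have hcop : ∀ x y : k, x ≠ y → IsCoprime (X - C x) (X - C y) := fun x y hxy =>
    isCoprime_X_sub_C_of_isUnit_sub (sub_ne_zero.mpr hxy).isUnit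
  have hcop' : ∀ x : k, x ≠ a → x ∉ T → IsCoprime (X - C x) ((X - C a) ^ 2 * ∏ i ∈ T, (X - C i)) :=
    fun x hxa hxT => IsCoprime.mul_right (hcop x a hxa).pow_right
      (IsCoprime.prod_right fun i hi => hcop x i fun h => hxT (h ▸ hi))
  refine ⟨c, a, ∏ i ∈ T, (X - C i), T, hc0, ((monic_X_sub_C a).pow 2).mul hgm, ?_, by omega,
    fun i hi => ?_, fun i hi => ?_, IsCoprime.mul_left (IsCoprime.pow_left ?_) ?_⟩
  · rw [((monic_X_sub_C a).pow 2).natDegree_mul hgm, (monic_X_sub_C a).natDegree_pow,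
      natDegree_X_sub_C, natDegree_prod_of_monic _ _ fun i _ => monic_X_sub_C i]
    simp only [natDegree_X_sub_C, Finset.sum_const, smul_eq_mul]
    omega
  · rw [eval_mul, eval_prod, Finset.prod_eq_zero hi (by simp), mul_zero]
  · rw [← Finset.mul_prod_erase T _ hi, mul_left_comm]
    simp only [derivative_mul, derivative_X_sub_C, eval_add, eval_mul, eval_sub, eval_X, eval_C,
      sub_self, zero_mul, add_zero, one_mul, eval_pow]
    refine mul_ne_zero (pow_ne_zero _ (sub_ne_zero.mpr (hT0 i hi).2.2)) ?_
    rw [eval_prod, Finset.prod_ne_zero_iff]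
    intro j hj
    simpa [sub_eq_zero] using (Finset.mem_erase.mp hj).1.symm
  · simpa using hcop' 0 ha0.symm fun h => (hT0 0 h).1 rfl
  · exact hcop' c hac.symm fun h => (hT0 c h).2.1 rfl

theorem exists_polynomial_gal_mulEquiv_perm [IsDomain A] [UniqueFactorizationMonoid A] [Infinite k]
    (ι : A →ₐ[k] E) (hι : Function.Injective ι) {m : ℕ} (hm : 3 ≤ m) :
    ∃ P : K[X], P.Separable ∧ Nonempty (Gal(P.SplittingField/K) ≃* Equiv.Perm (Fin m)) ∧
      ∃ β : P.SplittingField →+* LaurentSeries E, ∀ x : k,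
        β (algebraMap K P.SplittingField (algebraMap A[X] K (algebraMap k A[X] x))) =
        algebraMap (PowerSeries E) (LaurentSeries E) (algebraMap k (PowerSeries E) x) := by
  classical
  obtain ⟨c, a, g, T, hc, hh, hdeg, hTc, hT, hT', hcop⟩ := exists_finset_simple_roots (k := k) hm
  set h := (X - C a) ^ 2 * g with hhdef
  set f : k[X] := X ^ (m - 1) * (X - C c) with hf
  have hfm : f.Monic := (monic_X_pow _).mul (monic_X_sub_C c)
  have hfd : f.natDegree = h.natDegree := by
    rw [hdeg, hf, (monic_X_pow _).natDegree_mul (monic_X_sub_C c)]; simp; omega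
  have hnot : ∀ x : k, f.eval x = 0 → h.eval x = 0 → False := fun x h1 h2 => by
    have := hcop.map (evalRingHom x)
    simp [h1, h2] at this
  have hfa : f.eval a ≠ 0 := fun h1 => hnot a h1 (by simp [hhdef])
  have hh0 : h.eval 0 ≠ 0 := hnot 0 (by simp [hf]; omega)
  set P := (pencil f h (X : A[X])).map (algebraMap A[X] K) with hP
  have hPdeg : P.natDegree = m := by
    have := pencil_monic_natDegree hfm hh hfd (X : A[X])
    rw [hP, this.1.natDegree_map, this.2, hdeg]
  have hnoroot : ∀ b : K, ¬ P.IsRoot b :=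
    not_isRoot_pencil (by omega) hh (by omega) hcop
  have hinj := IsFractionRing.injective (PowerSeries E) (LaurentSeries E)
  obtain ⟨r, W, hWm, hW, hfac, hder⟩ :=
    exists_pencil_eq_linear_mul_irreducible (E := E) (d := m - 1) (by omega) hc hh (by omega) hh0
  rw [← hf] at hfac hder
  obtain ⟨ψ, -, hψ⟩ := exists_ringHom_laurentSeries (K := K) ι hι f h 0
    (w := PowerSeries.X) PowerSeries.X_ne_zero (by simp)
  obtain ⟨ψ', -, hψ'⟩ := exists_ringHom_laurentSeries (K := K) ι hι f h 1
    (w := PowerSeries.X) PowerSeries.X_ne_zero (by simp)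
  rw [map_zero, zero_add, ← hP, hfac, Polynomial.map_mul, Polynomial.map_sub, map_X, map_C] at hψ
  rw [map_one, ← hP] at hψ'
  have hW' := (hWm.irreducible_iff_irreducible_map_fraction_map (K := LaurentSeries E)).mp hW
  have hirr := irreducible_of_map_eq_linear_mul ψ hnoroot (by omega) hW' hψ
  have hsep : P.Separable := by
    rw [separable_iff_derivative_ne_zero hirr]
    intro h0
    apply hder
    apply hinj
    rw [← eval₂_at_apply, ← eval_map, ← derivative_map, hfac, Polynomial.map_mul,
      Polynomial.map_sub, map_X, map_C, ← hψ, derivative_map, h0]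
    simp
  refine ⟨P, hsep, ?_, ?_⟩
  · obtain ⟨S, hSc, hS⟩ := exists_finset_roots_pencil hfm hh hfd T hT hT'
      (1 + PowerSeries.X : PowerSeries E) (by simp)
    have hgal := nonempty_gal_mulEquiv_perm (L := P.SplittingField) P hsep hnoroot ψ _ _ hW' hψ ψ'
      (S.image (algebraMap (PowerSeries E) (LaurentSeries E)))
      (by rw [Finset.card_image_of_injective _ hinj]; omega)
      (fun y hy => by
        obtain ⟨s, hs, rfl⟩ := Finset.mem_image.mp hy
        rw [hψ', eval_map, eval₂_at_apply, (hS s hs).1, map_zero])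
      (by rw [hψ']; exact not_splits_pencil hfm hh hfd hfa)
    rwa [hPdeg] at hgal
  · obtain ⟨w, hw, hw0, hs⟩ := exists_splits_pencil (E := E) hfm hh hfd hfa T hT hT'
      (by rw [← hhdef]; omega)
    obtain ⟨χ, hχk, hχ⟩ := exists_ringHom_laurentSeries (K := K) ι hι f h 1 hw hw0
    rw [map_one, ← hP] at hχ
    let : Algebra K (LaurentSeries E) := χ.toAlgebra
    let β : P.SplittingField →ₐ[K] LaurentSeries E := IsSplittingField.lift _ P (by
      change (P.map χ).Splits
      rwa [hχ])
    refine ⟨β, fun x => ?_⟩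
    rw [← hχk]
    exact β.commutes _

end Global
end Pencil

section Domain

theorem isDomain_tensor_of_ringHom {k H K F L Δ : Type*} [Field k] [DivisionRing H] [Algebra k H]
    [Field K] [Algebra k K] [DivisionRing F] [Algebra K F] [Algebra.IsCentral K F] [Field L]
    [Algebra K L] [Ring Δ] [IsDomain Δ] (e : K ⊗[k] H ≃ₐ[K] F) (α : H →+* Δ) (β : L →+* Δ)
    (hβ : ∀ y d, β y * d = d * β y)
    (hαβ : ∀ x : k, α (algebraMap k H x) = β (algebraMap K L (algebraMap k K x))) :
    IsDomain (F ⊗[K] L) := by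
  let : Algebra K Δ := (β.comp (algebraMap K L)).toAlgebra' fun _ _ => hβ _ _
  let : Algebra k Δ := ((β.comp (algebraMap K L)).comp (algebraMap k K)).toAlgebra'
    fun _ _ => hβ _ _
  have : IsScalarTower k K Δ := IsScalarTower.of_algebraMap_eq fun _ => rfl
  let α' : H →ₐ[k] Δ := { α with commutes' := hαβ }
  let β' : L →ₐ[K] Δ := { β with commutes' := fun _ => rfl }
  let γ : F →ₐ[K] Δ := (Algebra.TensorProduct.lift (Algebra.ofId K Δ) α'
    fun x y => hβ (algebraMap K L x) (α y)).comp e.symm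
  exact (tensorLift_injective_of_isCentral γ β' β.injective
    fun x y => (hβ y (γ x)).symm).isDomain (Algebra.TensorProduct.lift γ β' _)

/-- The ring homomorphism on Laurent series induced by a map on coefficients. -/
def laurentMap {R S : Type*} [Ring R] [Ring S] (f : R →+* S) :
    LaurentSeries R →+* LaurentSeries S where
  toFun x := x.map f
  map_zero' := by ext; simp
  map_one' := by
    ext n
    simp [HahnSeries.coeff_one, apply_ite f]
  map_add' x y := by ext; simp
  map_mul' x y := HahnSeries.map_mul f.toNonUnitalRingHom

theorem laurentMap_C {R S : Type*} [Ring R] [Ring S] (f : R →+* S) (x : R) :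
    laurentMap f (HahnSeries.C x) = HahnSeries.C (f x) :=
  HahnSeries.map_C x f

theorem algebraMap_laurentSeries_eq_C {k E : Type*} [CommSemiring k] [Field E] [Algebra k E]
    (x : k) : algebraMap (PowerSeries E) (LaurentSeries E) (algebraMap k (PowerSeries E) x) =
      HahnSeries.C (algebraMap k E x) := by
  rw [LaurentSeries.coe_algebraMap, PowerSeries.algebraMap_apply, HahnSeries.ofPowerSeries_C]

theorem laurentMap_mul_comm {R S : Type*} [Ring R] [Ring S] (f : R →+* S)
    (hf : ∀ x y, f x * y = y * f x) (x : LaurentSeries R) (y : LaurentSeries S) :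
    laurentMap f x * y = y * laurentMap f x := by
  ext n
  rw [HahnSeries.coeff_mul, HahnSeries.coeff_mul]
  refine Finset.sum_bij' (fun a _ => a.swap) (fun a _ => a.swap) ?_ ?_ ?_ ?_ fun _ _ => hf _ _
  all_goals simp [and_assoc, and_comm, and_left_comm, add_comm]

end Domain

section Structure

/-- A commutative domain with central image in a division ring `F` has a fraction field, living in
the universe of `F`, over which `F` is an algebra. -/
theorem exists_central_fractionField {Z : Type*} [CommRing Z] [IsDomain Z] {F : Type u}
    [DivisionRing F] (ρ : Z →+* F) (hρ : Function.Injective ρ) (hc : ∀ z x, ρ z * x = x * ρ z) :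
    ∃ (K : Type u) (_ : Field K) (_ : Algebra Z K) (_ : Algebra K F), IsFractionRing Z K ∧
      ∀ z, algebraMap K F (algebraMap Z K z) = ρ z := by
  let ρ' : Z →+* Subring.center F := ρ.codRestrict _ fun z =>
    Subring.mem_center_iff.mpr fun x => (hc z x).symm
  have hρ' : Function.Injective ρ' := fun x y h => hρ (congrArg Subtype.val h)
  let ψ : FractionRing Z →+* Subring.center F := IsFractionRing.lift hρ'
  let K := ψ.fieldRange
  let e : FractionRing Z ≃+* K := RingEquiv.ofBijective ψ.rangeRestrictField
    ⟨ψ.rangeRestrictField.injective, fun ⟨_, y, hy⟩ => ⟨y, Subtype.ext hy⟩⟩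
  let : Algebra Z K := ((e : FractionRing Z →+* K).comp (algebraMap Z (FractionRing Z))).toAlgebra
  let i : K →+* F := (Subring.center F).subtype.comp K.subtype
  let : Algebra K F := i.toAlgebra' fun c x => (Subring.mem_center_iff.mp c.1.2 x).symm
  let e' : FractionRing Z ≃ₐ[Z] K := { e with commutes' := fun _ => rfl }
  refine ⟨K, inferInstance, inferInstance, inferInstance,
    IsLocalization.isLocalization_of_algEquiv _ e', fun z => ?_⟩
  exact congrArg Subtype.val (IsFractionRing.lift_algebraMap hρ' z)

section Quotient
variable {k H K F : Type*} [Field k] [DivisionRing H] [Algebra k H]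
  [Field K] [Algebra k K] [DivisionRing F] [Algebra k F] [Algebra K F] [IsScalarTower k K F]

/-- The algebra homomorphism `K ⊗ H → F` extending `η` on `H`. -/
noncomputable def extendScalars (η : H →ₐ[k] F) : K ⊗[k] H →ₐ[K] F :=
  Algebra.TensorProduct.lift (Algebra.ofId K F) η fun x y => Algebra.commutes x (η y)

theorem extendScalars_tmul (η : H →ₐ[k] F) (x : K) (y : H) :
    extendScalars η (x ⊗ₜ y) = algebraMap K F x * η y :=
  Algebra.TensorProduct.lift_tmul (Algebra.ofId K F) η _ x y

theorem extendScalars_injective [Algebra.IsCentral k H] (η : H →ₐ[k] F) :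
    Function.Injective (extendScalars (K := K) η) := by
  have hc (x : H) (y : K) : Commute (η x) (IsScalarTower.toAlgHom k K F y) :=
    (Algebra.commutes y (η x)).symm
  have h := tensorLift_injective_of_isCentral η (IsScalarTower.toAlgHom k K F)
    (algebraMap K F).injective hc
  have heq : ∀ z : K ⊗[k] H, extendScalars η z =
      Algebra.TensorProduct.lift η (IsScalarTower.toAlgHom k K F) hc
        (Algebra.TensorProduct.comm k K H z) := by
    intro z
    induction z using TensorProduct.induction_on with
    | zero => simp
    | tmul x y =>
      rw [extendScalars_tmul, Algebra.TensorProduct.comm_tmul, Algebra.TensorProduct.lift_tmul]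
      exact Algebra.commutes x (η y)
    | add x y hx hy => rw [map_add, hx, hy, map_add, map_add]
  intro x y hxy
  rw [heq, heq] at hxy
  exact (Algebra.TensorProduct.comm k K H).injective (h hxy)

theorem extendScalars_surjective [FiniteDimensional k H] (η : H →ₐ[k] F) (S : Subring F)
    (hS : ∀ x ∈ S, x ∈ (extendScalars (K := K) η).range)
    (hF : ∀ x : F, ∃ a ∈ S, ∃ b ∈ S, x = a * b⁻¹) :
    Function.Surjective (extendScalars (K := K) η) := by
  set lam := extendScalars (K := K) η
  have : FiniteDimensional K lam.range := Module.Finite.range lam.toLinearMap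
  rw [← AlgHom.range_eq_top, eq_top_iff]
  rintro x -
  obtain ⟨a, ha, b, hb, rfl⟩ := hF x
  refine lam.range.mul_mem (hS a ha) ?_
  rcases eq_or_ne b 0 with rfl | hb0
  · simp
  have hinj : Function.Injective (LinearMap.mulLeft K (⟨b, hS b hb⟩ : lam.range)) := by
    intro x y hxy
    exact Subtype.ext (mul_left_cancel₀ hb0 (congrArg Subtype.val hxy))
  obtain ⟨y, hy⟩ := LinearMap.injective_iff_surjective.mp hinj 1
  rw [← eq_inv_of_mul_eq_one_right (congrArg Subtype.val hy)]
  exact y.2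

theorem isCentral_of_extendScalars_surjective [Algebra.IsCentral k H] (η : H →ₐ[k] F)
    (h : Function.Surjective (extendScalars (K := K) η)) : Algebra.IsCentral K F where
  out x hx := by
    obtain ⟨z, rfl⟩ := h x
    obtain ⟨c, hc⟩ := exists_of_commute_includeLeft (Algebra.TensorProduct.comm k K H z) fun d => by
      have h1 : Commute ((1 : K) ⊗ₜ[k] d) z := by
        apply extendScalars_injective η
        rw [map_mul, map_mul]
        exact Subalgebra.mem_center_iff.mp hx _
      simpa using h1.map (Algebra.TensorProduct.comm k K H)
    have hz : z = c ⊗ₜ 1 := by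
      apply (Algebra.TensorProduct.comm k K H).injective
      rw [← hc]; simp
    rw [hz, Algebra.mem_bot, extendScalars_tmul]
    exact ⟨c, by simp⟩

end Quotient

section PolyFun
variable {H : Type*} [DivisionRing H]

instance isCentral_subringCenter : Algebra.IsCentral (Subring.center H) H where
  out x hx := Algebra.mem_bot.mpr
    ⟨⟨x, Subring.mem_center_iff.mpr fun y => Subalgebra.mem_center_iff.mp hx y⟩, rfl⟩

theorem const_mem_polyFunRing (c : H) : Function.const H c ∈ polyFunRing H :=
  Subring.subset_closure (Or.inl ⟨c, rfl⟩)

theorem id_mem_polyFunRing : (id : H → H) ∈ polyFunRing H :=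
  Subring.subset_closure (Or.inr rfl)

variable [FiniteDimensional (Subring.center H) H]

theorem linearMap_mem_polyFunRing (T : Module.End (Subring.center H) H) :
    (T : H → H) ∈ polyFunRing H := by
  let k := Subring.center H
  let f : H →ₐ[k] Module.End k H := Algebra.lmul k H
  let g : Hᵐᵒᵖ →ₐ[k] Module.End k H := Algebra.lsmul k k H
  have hc : ∀ x y, Commute (f x) (g y) := fun x y => LinearMap.ext fun v => by
    simp [f, g, mul_assoc]
  have hg : Function.Injective g := g.toRingHom.injective
  have hinj := tensorLift_injective_of_isCentral f g hg hc
  have hsurj : Function.Surjective (Algebra.TensorProduct.lift f g hc) := by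
    apply (LinearMap.injective_iff_surjective_of_finrank_eq_finrank
      (f := (Algebra.TensorProduct.lift f g hc).toLinearMap) ?_).mp hinj
    rw [Module.finrank_tensorProduct, Module.finrank_linearMap, MulOpposite.finrank]
  obtain ⟨z, rfl⟩ := hsurj T
  induction z using TensorProduct.induction_on with
  | zero => rw [map_zero]; exact (polyFunRing H).zero_mem
  | tmul x y =>
    have : (Algebra.TensorProduct.lift f g hc (x ⊗ₜ y) : H → H) =
        Function.const H x * (id * Function.const H y.unop) := by
      ext v
      simp [f, g]
    rw [this]
    exact mul_mem (const_mem_polyFunRing x) (mul_mem id_mem_polyFunRing (const_mem_polyFunRing _))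
  | add x y hx hy => rw [map_add]; exact (polyFunRing H).add_mem hx hy

/-- Polynomials in the coordinates of a basis of `H` over its center, as functions on `H`. -/
noncomputable def coordPolyFun {ι : Type*} [Finite ι] (b : Module.Basis ι (Subring.center H) H) :
    MvPolynomial ι (Subring.center H) →+* polyFunRing H :=
  (RingHom.pi fun x => (algebraMap (Subring.center H) H).comp
    (MvPolynomial.eval (b.repr x))).codRestrict (polyFunRing H) fun p => by
      induction p using MvPolynomial.induction_on with
      | C a =>
        convert const_mem_polyFunRing (a : H) using 1
        funext x
        exact congrArg (algebraMap (Subring.center H) H) (MvPolynomial.eval_C a)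
      | add p q hp hq => rw [map_add]; exact add_mem hp hq
      | mul_X p i hp =>
        rw [map_mul]
        refine mul_mem hp ?_
        convert linearMap_mem_polyFunRing
          ((Algebra.linearMap (Subring.center H) H).comp (b.coord i)) using 1
        funext x
        simp

theorem coordPolyFun_apply {ι : Type*} [Finite ι] (b : Module.Basis ι (Subring.center H) H)
    (p : MvPolynomial ι (Subring.center H)) (x : H) :
    (coordPolyFun b p : H → H) x = (MvPolynomial.eval (b.repr x) p : Subring.center H) := rfl

theorem coordPolyFun_injective [Infinite (Subring.center H)] {ι : Type*} [Finite ι]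
    (b : Module.Basis ι (Subring.center H) H) : Function.Injective (coordPolyFun b) := by
  intro p q h
  apply MvPolynomial.funext
  intro v
  have h1 := congrFun (congrArg Subtype.val h) (b.equivFun.symm v)
  rw [coordPolyFun_apply, coordPolyFun_apply] at h1
  have h2 := Subtype.ext h1
  rwa [← Module.Basis.equivFun_apply, LinearEquiv.apply_symm_apply] at h2

theorem coordPolyFun_mul_comm {ι : Type*} [Finite ι] (b : Module.Basis ι (Subring.center H) H)
    (p : MvPolynomial ι (Subring.center H)) (r : polyFunRing H) :
    coordPolyFun b p * r = r * coordPolyFun b p := by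
  apply Subtype.ext
  funext x
  exact (Subring.mem_center_iff.mp (MvPolynomial.eval (b.repr x) p).2 (r.1 x)).symm

end PolyFun
end Structure

section Assembly

theorem commute_of_isClassicalRightQuotient {R F : Type*} [Ring R] [DivisionRing F] {φ : R →+* F}
    (hφ : IsClassicalRightQuotient φ) {r : R} (hr : ∀ s, r * s = s * r) (x : F) :
    φ r * x = x * φ r := by
  obtain ⟨a, b, -, rfl⟩ := hφ.2 x
  have h (s : R) : Commute (φ r) (φ s) := by
    rw [Commute, SemiconjBy, ← map_mul, hr, map_mul]
  exact (h a).mul_right (h b).inv_right₀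

/-- The embedding of `H` into the polynomial functions as the constant functions. -/
def constPolyFun (H : Type*) [DivisionRing H] : H →+* polyFunRing H :=
  (Pi.constRingHom H H).codRestrict _ const_mem_polyFunRing

theorem coordPolyFun_C {H : Type*} [DivisionRing H] [FiniteDimensional (Subring.center H) H]
    {ι : Type*} [Finite ι] (b : Module.Basis ι (Subring.center H) H) (c : Subring.center H) :
    coordPolyFun b (MvPolynomial.C c) = constPolyFun H c :=
  Subtype.ext (funext fun _ => congrArg Subtype.val (MvPolynomial.eval_C c))

theorem polyFunRing_induction {H : Type*} [DivisionRing H]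
    [FiniteDimensional (Subring.center H) H] {ι : Type*} [Fintype ι]
    (b : Module.Basis ι (Subring.center H) H) (S : Subring (polyFunRing H))
    (hconst : ∀ c, constPolyFun H c ∈ S) (hcoord : ∀ p, coordPolyFun b p ∈ S)
    (r : polyFunRing H) : r ∈ S := by
  suffices h : polyFunRing H ≤ S.map (polyFunRing H).subtype by
    obtain ⟨s, hs, hsr⟩ := h r.2
    rwa [← Subtype.ext hsr]
  refine Subring.closure_le.mpr ?_
  rintro f (⟨c, rfl⟩ | rfl)
  · exact ⟨_, hconst c, rfl⟩
  · refine ⟨∑ i, coordPolyFun b (MvPolynomial.X i) * constPolyFun H (b i),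
      sum_mem fun i _ => mul_mem (hcoord _) (hconst _), ?_⟩
    rw [map_sum]
    funext x
    rw [Finset.sum_apply]
    calc ∑ i, ((MvPolynomial.eval (b.repr x) (MvPolynomial.X i) : Subring.center H) : H) * b i
        = ∑ i, b.repr x i • b i := by simp [Subring.smul_def]
      _ = x := b.sum_repr x

theorem exists_isGaloisExt_of_isDomain_tensor {K F L : Type u} [Field K] [DivisionRing F]
    [Algebra K F] [Algebra.IsCentral K F] [FiniteDimensional K F] [Field L] [Algebra K L]
    [FiniteDimensional K L] [IsGalois K L] [IsDomain (F ⊗[K] L)] :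
    ∃ (M : Type u) (instM : DivisionRing M),
      letI := instM
      ∃ ι : F →+* M, Function.Injective ι ∧ IsGaloisExt ι ∧
        Nonempty (fixingAut ι ≃* Gal(L/K)) := by
  let := divisionRingOfFiniteDimensional K (F ⊗[K] L)
  let e : F ⊗[K] L ≃+* F ⊗[K] L := RingEquiv.refl _
  exact ⟨F ⊗[K] L, inferInstance, _, RingHom.injective _, isGaloisExt_tensor e,
    ⟨(MulEquiv.ofBijective (tensorAut e) (tensorAut_bijective e)).symm⟩⟩

end Assembly

theorem symmetric_groups_are_galois_groups_over_polyFun_fractions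
    {H : Type v} [DivisionRing H] [FiniteDimensional (Subring.center H) H]
    (hk : Infinite (Subring.center H))
    {F : Type u} [DivisionRing F]
    (φ : polyFunRing H →+* F) (hφ : IsClassicalRightQuotient φ)
    (m : ℕ) (hm : 3 ≤ m) :
    ∃ (M : Type u) (instM : DivisionRing M),
      letI := instM
      ∃ ι : F →+* M, Function.Injective ι ∧ IsGaloisExt ι ∧
        Nonempty (fixingAut ι ≃* Equiv.Perm (Fin m)) := by
  let k := Subring.center H
  obtain ⟨n, hn⟩ := Nat.exists_eq_succ_of_ne_zero (Module.finrank_pos (R := k) (M := H)).ne'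
  let b : Module.Basis (Fin (n + 1)) k H := Module.finBasisOfFinrankEq k H hn
  let A := MvPolynomial (Fin n) k
  let δ : Polynomial A →+* polyFunRing H :=
    (coordPolyFun b).comp (MvPolynomial.finSuccEquiv k n).symm.toRingEquiv.toRingHom
  have hδC (x : k) : δ (algebraMap k (Polynomial A) x) = constPolyFun H x := by
    rw [← coordPolyFun_C b]
    exact congrArg (coordPolyFun b) ((MvPolynomial.finSuccEquiv k n).symm.commutes x)
  have hδ (p : MvPolynomial (Fin (n + 1)) k) :
      δ (MvPolynomial.finSuccEquiv k n p) = coordPolyFun b p :=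
    congrArg (coordPolyFun b) ((MvPolynomial.finSuccEquiv k n).symm_apply_apply p)
  obtain ⟨K, _, _, _, _, hKF⟩ := exists_central_fractionField (φ.comp δ)
    (hφ.1.comp ((coordPolyFun_injective b).comp (MvPolynomial.finSuccEquiv k n).symm.injective))
    fun z x => commute_of_isClassicalRightQuotient hφ (coordPolyFun_mul_comm b _) x
  let : Algebra k K := ((algebraMap (Polynomial A) K).comp (algebraMap k (Polynomial A))).toAlgebra
  let : Algebra k F := ((algebraMap K F).comp (algebraMap k K)).toAlgebra'
    fun _ _ => Algebra.commutes _ _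
  have : IsScalarTower k K F := IsScalarTower.of_algebraMap_eq fun _ => rfl
  let η : H →ₐ[k] F :=
    { φ.comp (constPolyFun H) with
      commutes' := fun x => ((hKF _).trans (congrArg φ (hδC x))).symm }
  have hsurj : Function.Surjective (extendScalars (K := K) η) := by
    refine extendScalars_surjective η φ.range ?_ fun x => ?_
    · rintro _ ⟨r, rfl⟩
      refine polyFunRing_induction b ((extendScalars (K := K) η).range.toSubring.comap φ)
        (fun c => ⟨1 ⊗ₜ c, ?_⟩)
        (fun p => ⟨algebraMap _ K (MvPolynomial.finSuccEquiv k n p) ⊗ₜ 1, ?_⟩) r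
      · refine (extendScalars_tmul η 1 c).trans ?_
        rw [map_one, one_mul]
        rfl
      · refine (extendScalars_tmul η _ 1).trans ?_
        rw [map_one, mul_one, hKF]
        exact congrArg φ (hδ p)
    · obtain ⟨r, s, -, hx⟩ := hφ.2 x
      exact ⟨φ r, ⟨r, rfl⟩, φ s, ⟨s, rfl⟩, hx⟩
  have : Algebra.IsCentral K F := isCentral_of_extendScalars_surjective η hsurj
  let e : K ⊗[k] H ≃ₐ[K] F :=
    AlgEquiv.ofBijective (extendScalars η) ⟨extendScalars_injective η, hsurj⟩
  have : FiniteDimensional K F := Module.Finite.equiv e.toLinearEquiv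
  let ι : A →ₐ[k] K :=
    { (algebraMap (Polynomial A) K).comp Polynomial.C with commutes' := fun _ => rfl }
  obtain ⟨P, hP, ⟨eP⟩, β, hβ⟩ := exists_polynomial_gal_mulEquiv_perm (K := K) ι
    ((IsFractionRing.injective (Polynomial A) K).comp Polynomial.C_injective) hm
  have : IsGalois K P.SplittingField := IsGalois.of_separable_splitting_field hP
  have : IsDomain (F ⊗[K] P.SplittingField) := by
    refine isDomain_tensor_of_ringHom e ((HahnSeries.C : F →+* LaurentSeries F).comp η)
      ((laurentMap (algebraMap K F)).comp β)
      (fun y d => laurentMap_mul_comm _ (fun x y => Algebra.commutes x y) _ d) fun x => ?_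
    change HahnSeries.C (η (algebraMap k H x)) = laurentMap (algebraMap K F) (β _)
    rw [η.commutes, IsScalarTower.algebraMap_apply k K F]
    refine Eq.trans ?_ (congrArg (laurentMap (algebraMap K F)) ((hβ x).trans
      (algebraMap_laurentSeries_eq_C x))).symm
    exact (laurentMap_C _ _).symm
  obtain ⟨M, instM, ι, hι, hgal, ⟨eM⟩⟩ :=
    exists_isGaloisExt_of_isDomain_tensor (K := K) (F := F) (L := P.SplittingField)
  exact ⟨M, instM, ι, hι, hgal, ⟨eM.trans eP⟩⟩
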